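/- arXiv:1511.08724 — 3 statements merged into one kernel-verified Lean document; each statement's English description precedes it below -/
import Mathlib

section
/- Let T = (Q, Q₀, A, rewards, δ) be a task and let π be a policy with forward(π) ⊆ backward(π). Then every trial whose first configuration is a start configuration (q₀, π, ∅) with q₀ ∈ Q₀ is such that: every configuration of the trial carries the policy π (including the terminal configuration, if any), no configuration at a non-terminal position is branching, and for every i the state of the i-th configuration of the trial belongs to the i-th forward layer Fᵢ of π. -/
/-!
Formalization of the navigational reinforcement learning framework of
Ameloot & Van den Bussche, "On the convergence of cycle detection for
navigational reinforcement learning".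
-/

/-- A task `T = (Q, Q₀, A, rewards, δ)`: `Q` and `A` are (finite, nonempty) types,
`start` is a nonempty set of start states, `rewards` a nonempty set of
state-action pairs and `delta` maps each state-action pair to a nonempty
set of successor states. -/
structure NavTask (Q A : Type) where
  start : Set Q
  start_nonempty : start.Nonempty
  rewards : Set (Q × A)
  rewards_nonempty : rewards.Nonempty
  delta : Q → A → Set Q
  delta_nonempty : ∀ q a, (delta q a).Nonempty

namespace NavTask

variable {Q A : Type}

/-- The goal states of a task. -/
def goals (T : NavTask Q A) : Set Q := {q | ∃ a, (q, a) ∈ T.rewards}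

/-- The reducibility layers relative to a set `S`; `layers S 0` is the layer `F₁ = S`
of the paper, and `layers S n` is the layer `F_{n+1}`. -/
def layers (T : NavTask Q A) (S : Set Q) : ℕ → Set Q
  | 0 => S
  | n + 1 => T.layers S n ∪ {q | ∃ a, T.delta q a ⊆ T.layers S n}

/-- `S'` is reducible to `S`. -/
def ReducibleTo (T : NavTask Q A) (S' S : Set Q) : Prop := S' ⊆ ⋃ n, T.layers S n

/-- `reduce T`: the set of states reducible to the goal states. -/
def reduce (T : NavTask Q A) : Set Q := ⋃ n, T.layers T.goals n

/-- A task is reducible if all states are reducible to the goal states. -/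
def Reducible (T : NavTask Q A) : Prop := T.ReducibleTo Set.univ T.goals

end NavTask

/-- A configuration `(q, π, V)`: current state, policy, working memory. -/
structure Config (Q A : Type) where
  state : Q
  pol : Q → A
  mem : Set Q

namespace Config

variable {Q A : Type}

/-- A configuration is branching if its current state has already been visited. -/
def Branching (c : Config Q A) : Prop := c.state ∈ c.mem

/-- Applying an option `(a, q')` to a configuration: move to `q'`, record action `a`
for the departed state, and mark the departed state as visited. -/
noncomputable def apply (c : Config Q A) (a : A) (q' : Q) : Config Q A :=
  letI := Classical.decEq Q
  ⟨q', Function.update c.pol c.state a, c.mem ∪ {c.state}⟩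

end Config

/-- A transition: a four-tuple (source configuration, action, chosen successor
state, target configuration). -/
structure Step (Q A : Type) where
  src : Config Q A
  act : A
  nxt : Q
  tgt : Config Q A

namespace NavTask

variable {Q A : Type}

/-- The options of a configuration: all actions if branching, otherwise only
the action given by the policy, paired with possible successor states. -/
def opts (T : NavTask Q A) (c : Config Q A) : Set (A × Q) :=
  {p | (c.Branching ∨ p.1 = c.pol c.state) ∧ p.2 ∈ T.delta c.state p.1}

/-- Validity of a transition. -/
def ValidStep (T : NavTask Q A) (t : Step Q A) : Prop :=
  (t.act, t.nxt) ∈ T.opts t.src ∧ t.tgt = t.src.apply t.act t.nxt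

/-- A reward transition. -/
def IsRewardStep (T : NavTask Q A) (t : Step Q A) : Prop :=
  (t.src.state, t.act) ∈ T.rewards

end NavTask

/-- A finite list of transitions is a chain: each target is the next source. -/
def IsChainList {Q A : Type} (l : List (Step Q A)) : Prop :=
  ∀ i (h : i + 1 < l.length),
    (l[i]'(Nat.lt_of_succ_lt h)).tgt = (l[i + 1]'h).src

/-- The first (source) configuration of a finite chain, if any. -/
def firstSrc? {Q A : Type} (l : List (Step Q A)) : Option (Config Q A) :=
  l.head?.map Step.src

/-- The last (target, i.e. terminal) configuration of a finite chain, if any. -/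
def lastTgt? {Q A : Type} (l : List (Step Q A)) : Option (Config Q A) :=
  l.getLast?.map Step.tgt

namespace NavTask

variable {Q A : Type}

/-- A finite trial: a nonempty valid chain ending with a reward transition and
containing no other reward transitions. -/
def IsFinTrial (T : NavTask Q A) (l : List (Step Q A)) : Prop :=
  l ≠ [] ∧ IsChainList l ∧ (∀ t ∈ l, T.ValidStep t) ∧
  (∀ t ∈ l.getLast?, T.IsRewardStep t) ∧
  (∀ i (h : i + 1 < l.length), ¬ T.IsRewardStep (l[i]'(Nat.lt_of_succ_lt h)))

/-- An infinite trial: an infinite valid chain with no reward transitions. -/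
def IsInfTrial (T : NavTask Q A) (g : ℕ → Step Q A) : Prop :=
  (∀ n, T.ValidStep (g n)) ∧ (∀ n, (g n).tgt = (g (n + 1)).src) ∧
  (∀ n, ¬ T.IsRewardStep (g n))

/-- A start configuration: a start state with empty working memory. -/
def IsStartConfig (T : NavTask Q A) (c : Config Q A) : Prop :=
  c.state ∈ T.start ∧ c.mem = ∅

/-- When a trial ends with `c₁`, the next trial starts with a configuration `c₂`
whose state is a start state, with the same policy, and empty working memory. -/
def Succession (T : NavTask Q A) (c₁ c₂ : Config Q A) : Prop :=
  c₂.state ∈ T.start ∧ c₂.pol = c₁.pol ∧ c₂.mem = ∅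

end NavTask

/-- A trial is either a finite or an infinite chain of transitions. -/
inductive Trial (Q A : Type) where
  | fin : List (Step Q A) → Trial Q A
  | inf : (ℕ → Step Q A) → Trial Q A

namespace Trial

variable {Q A : Type}

/-- A trial is finite (terminates). -/
def IsFinite : Trial Q A → Prop
  | .fin _ => True
  | .inf _ => False

/-- The configuration occurring at (0-based) position `n` of a trial: sources of
the transitions, plus (for a finite trial) the terminal configuration. -/
def config? : Trial Q A → ℕ → Option (Config Q A)
  | .fin l, n =>
      if h : n < l.length then some (l[n]'h).src
      else if n = l.length then lastTgt? l else none
  | .inf g, n => some (g n).src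

/-- Position `n` of a trial is non-terminal. -/
def NonTerminal : Trial Q A → ℕ → Prop
  | .fin l, n => n < l.length
  | .inf _, _ => True

/-- The positions at which state `q` occurs in a trial. -/
def stateOccs (tr : Trial Q A) (q : Q) : Set ℕ :=
  {n | ∃ c ∈ tr.config? n, c.state = q}

end Trial

/-- Validity of a trial. -/
def NavTask.IsTrial {Q A : Type} (T : NavTask Q A) : Trial Q A → Prop
  | .fin l => T.IsFinTrial l
  | .inf g => T.IsInfTrial g

/-- A run: either an infinite sequence of finite trials, or finitely many finite
trials followed by one infinite trial. -/
inductive Run (Q A : Type) where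
  | allFin : (ℕ → List (Step Q A)) → Run Q A
  | withInf : List (List (Step Q A)) → (ℕ → Step Q A) → Run Q A

/-- Validity of a run on a task. -/
def NavTask.IsRun {Q A : Type} (T : NavTask Q A) : Run Q A → Prop
  | .allFin f =>
      (∀ n, T.IsFinTrial (f n)) ∧
      (∀ c ∈ firstSrc? (f 0), T.IsStartConfig c) ∧
      (∀ n, ∀ c₁ ∈ lastTgt? (f n), ∀ c₂ ∈ firstSrc? (f (n + 1)), T.Succession c₁ c₂) ∧
      (∀ q ∈ T.start, {n | ∃ c ∈ firstSrc? (f n), c.state = q}.Infinite)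
  | .withInf L g =>
      (∀ l ∈ L, T.IsFinTrial l) ∧ T.IsInfTrial g ∧
      (L = [] → T.IsStartConfig (g 0).src) ∧
      (∀ l ∈ L.head?, ∀ c ∈ firstSrc? l, T.IsStartConfig c) ∧
      (∀ i (h : i + 1 < L.length),
        ∀ c₁ ∈ lastTgt? (L[i]'(Nat.lt_of_succ_lt h)),
        ∀ c₂ ∈ firstSrc? (L[i + 1]'h), T.Succession c₁ c₂) ∧
      (∀ c₁ ∈ lastTgt? (L.getLast?.getD []), T.Succession c₁ (g 0).src)

namespace Run

variable {Q A : Type}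

/-- The trials of a run. -/
def trials : Run Q A → Set (Trial Q A)
  | .allFin f => {tr | ∃ n, tr = .fin (f n)}
  | .withInf L g => {tr | (∃ l ∈ L, tr = .fin l) ∨ tr = .inf g}

/-- `P` holds at infinitely many transitions (equivalently, non-terminal
configuration occurrences) of the run, restricted to trials of index `≥ i`. -/
def InfOftenFrom : Run Q A → ℕ → (Step Q A → Prop) → Prop
  | .allFin f, i, P =>
      {p : ℕ × ℕ | i ≤ p.1 ∧ ∃ h : p.2 < (f p.1).length, P ((f p.1)[p.2]'h)}.Infinite
  | .withInf L g, i, P => i ≤ L.length ∧ {n | P (g n)}.Infinite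

/-- `P` holds at infinitely many transitions of the run. -/
def InfOften (R : Run Q A) (P : Step Q A → Prop) : Prop := R.InfOftenFrom 0 P

/-- A state is stable: only finitely many non-terminal occurrences of branching
configurations containing it. -/
def Stable (R : Run Q A) (q : Q) : Prop :=
  ¬ R.InfOften (fun t => t.src.state = q ∧ t.src.Branching)

/-- All trials of the run are finite. -/
def AllFinite : Run Q A → Prop
  | .allFin _ => True
  | .withInf _ _ => False

/-- A run converges: all trials terminate (with reward) and every state
eventually becomes stable. -/
def Converges (R : Run Q A) : Prop := R.AllFinite ∧ ∀ q, R.Stable q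

/-- Only finitely many trials contain more than `k` non-terminal configurations;
equivalently, from some trial index on, every trial has at most `k`
non-terminal configurations (sources of transitions). -/
def EventuallyBounded : Run Q A → ℕ → Prop
  | .allFin f, k => {n | k < (f n).length}.Finite
  | .withInf _ _, _ => False

/-- After trial `i` there are no more branching configurations at
non-terminal positions. -/
def NoBranchingAfter : Run Q A → ℕ → Prop
  | .allFin f, i => ∀ m, i < m → ∀ t ∈ f m, ¬ t.src.Branching
  | .withInf L g, i =>
      (∀ m, i < m → ∀ l ∈ L[m]?, ∀ t ∈ l, ¬ t.src.Branching) ∧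
      (i < L.length → ∀ n, ¬ (g n).src.Branching)

/-- Trial `i` of the run terminates (is finite). -/
def TrialTerminates : Run Q A → ℕ → Prop
  | .allFin _, _ => True
  | .withInf L _, i => i < L.length

/-- `i` is the convergence-trial index: the smallest trial index such that trial `i`
terminates and after trial `i` there are no branching configurations at
non-terminal positions. -/
def IsConvIndex (R : Run Q A) (i : ℕ) : Prop :=
  R.TrialTerminates i ∧ R.NoBranchingAfter i ∧
  ∀ j < i, ¬ (R.TrialTerminates j ∧ R.NoBranchingAfter j)

/-- `π` is the policy at the end of trial `i` of the run. -/
def EndPolicyAt : Run Q A → ℕ → (Q → A) → Prop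
  | .allFin f, i, π => ∃ t ∈ (f i).getLast?, t.tgt.pol = π
  | .withInf L _, i, π => ∃ l ∈ L[i]?, ∃ t ∈ l.getLast?, t.tgt.pol = π

/-- `π` is the final policy of the run: the policy at the end of the
convergence-trial. -/
def IsFinalPolicy (R : Run Q A) (π : Q → A) : Prop :=
  ∃ i, R.IsConvIndex i ∧ R.EndPolicyAt i π

/-- `π` occurs in the run at the end of some trial. -/
def EndsPolicy (R : Run Q A) (π : Q → A) : Prop := ∃ i, R.EndPolicyAt i π

end Run

namespace NavTask

variable {Q A : Type}

/-- Fairness: every configuration occurring infinitely often at non-terminal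
positions has each of its options taken infinitely often. -/
def Fair (T : NavTask Q A) (R : Run Q A) : Prop :=
  ∀ c : Config Q A, R.InfOften (fun t => t.src = c) →
    ∀ p ∈ T.opts c,
      R.InfOften (fun t => t = ⟨c, p.1, p.2, c.apply p.1 p.2⟩)

/-- A task is learnable under fairness if every fair run on it converges. -/
def Learnable (T : NavTask Q A) : Prop :=
  ∀ R : Run Q A, T.IsRun R → T.Fair R → R.Converges

/-- `ground π`: goal states assigned a rewarding action by the policy. -/
def ground (T : NavTask Q A) (π : Q → A) : Set Q := {q | (q, π q) ∈ T.rewards}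

/-- The forward layers of a policy; `fwd π 0` is `F₁ = Q₀` of the paper. -/
def fwd (T : NavTask Q A) (π : Q → A) : ℕ → Set Q
  | 0 => T.start
  | n + 1 => T.fwd π n ∪ ⋃ q ∈ T.fwd π n \ T.ground π, T.delta q (π q)

/-- `forward π`: states reachable from the start states by following `π`. -/
def forward (T : NavTask Q A) (π : Q → A) : Set Q := ⋃ n, T.fwd π n

/-- The backward layers of a policy; `bwd π 0` is `B₁ = ground(π)` of the paper. -/
def bwd (T : NavTask Q A) (π : Q → A) : ℕ → Set Q
  | 0 => T.ground π
  | n + 1 => T.bwd π n ∪ {q | T.delta q (π q) ⊆ T.bwd π n}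

/-- `backward π`: states reduced by `π` to the goal states in `ground π`. -/
def backward (T : NavTask Q A) (π : Q → A) : Set Q := ⋃ n, T.bwd π n

/-- A (simple) path from `q` to `q'`: non-reward transitions, pairwise distinct
states. -/
def Path (T : NavTask Q A) (q q' : Q) : Prop :=
  ∃ (n : ℕ) (s : ℕ → Q) (a : ℕ → A),
    s 0 = q ∧ s n = q' ∧
    (∀ i < n, s (i + 1) ∈ T.delta (s i) (a i)) ∧
    (∀ i < n, (s i, a i) ∉ T.rewards) ∧
    (∀ i ≤ n, ∀ j ≤ n, i ≠ j → s i ≠ s j)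

/-- A state is reachable: there is a path from some start state to it. -/
def Reachable (T : NavTask Q A) (q : Q) : Prop := ∃ q₀ ∈ T.start, T.Path q₀ q

/-- A state has a path to a set `S`. -/
def HasPathTo (T : NavTask Q A) (q : Q) (S : Set Q) : Prop := ∃ q' ∈ S, T.Path q q'

end NavTask

namespace NavTask

variable {Q A : Type} {T : NavTask Q A} {π : Q → A}

theorem bwd_monotone (T : NavTask Q A) (π : Q → A) : Monotone (T.bwd π) :=
  monotone_nat_of_le_succ fun _ => Set.subset_union_left

/-- Away from `ground π`, following `π` strictly decreases the backward layer. -/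
theorem exists_notMem_bwd_delta_subset {q : Q} (hq : q ∈ T.backward π) (hg : q ∉ T.ground π) :
    ∃ m, q ∉ T.bwd π m ∧ T.delta q (π q) ⊆ T.bwd π m := by
  classical
  have hex : ∃ n, q ∈ T.bwd π n := Set.mem_iUnion.mp hq
  obtain ⟨m, hm⟩ : ∃ m, Nat.find hex = m + 1 :=
    Nat.exists_eq_succ_of_ne_zero fun h => hg (by simpa [h, bwd] using Nat.find_spec hex)
  have hnot : q ∉ T.bwd π m := Nat.find_min hex (by omega)
  have hmem : q ∈ T.bwd π (m + 1) := hm ▸ Nat.find_spec hex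
  exact ⟨m, hnot, hmem.resolve_left hnot⟩

/-- The configuration `c` carries `π`, its state lies in the forward layer `n`, and every
visited state is separated from the current one by some backward layer. -/
structure Follows (T : NavTask Q A) (π : Q → A) (n : ℕ) (c : Config Q A) : Prop where
  pol_eq : c.pol = π
  state_mem : c.state ∈ T.fwd π n
  mem_separated : ∀ q ∈ c.mem, ∃ k, c.state ∈ T.bwd π k ∧ q ∉ T.bwd π k

namespace Follows

variable {n : ℕ} {t : Step Q A}

theorem not_branching {c : Config Q A} (h : T.Follows π n c) : ¬ c.Branching := fun hb =>
  let ⟨_, hin, hout⟩ := h.mem_separated _ hb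
  hout hin

theorem act_eq (h : T.Follows π n t.src) (ht : T.ValidStep t) : t.act = π t.src.state := by
  rw [← h.pol_eq]
  exact ht.1.1.resolve_left h.not_branching

theorem tgt_pol_eq (h : T.Follows π n t.src) (ht : T.ValidStep t) : t.tgt.pol = π := by
  rw [ht.2, Config.apply, h.act_eq ht, h.pol_eq]
  let := Classical.decEq Q
  exact Function.update_eq_self _ _

theorem tgt (hfb : T.forward π ⊆ T.backward π) (h : T.Follows π n t.src)
    (ht : T.ValidStep t) (hr : ¬ T.IsRewardStep t) : T.Follows π (n + 1) t.tgt := by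
  have hact := h.act_eq ht
  have hg : t.src.state ∉ T.ground π := fun hg => hr (by rw [IsRewardStep, hact]; exact hg)
  have hnxt : t.nxt ∈ T.delta t.src.state (π t.src.state) := hact ▸ ht.1.2
  obtain ⟨m, hm, hsub⟩ :=
    exists_notMem_bwd_delta_subset (hfb (Set.mem_iUnion_of_mem n h.state_mem)) hg
  refine ⟨h.tgt_pol_eq ht, ?_, ?_⟩ <;> rw [ht.2]
  · exact Or.inr (Set.mem_biUnion ⟨h.state_mem, hg⟩ hnxt)
  · rintro q (hq | rfl)
    · obtain ⟨k, hk, hqk⟩ := h.mem_separated q hq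
      have hmk : m ≤ k := (not_le.mp fun hkm => hm (T.bwd_monotone π hkm hk)).le
      exact ⟨m, hsub hnxt, fun hqm => hqk (T.bwd_monotone π hmk hqm)⟩
    · exact ⟨m, hsub hnxt, hm⟩

end Follows

theorem follows_start {q : Q} (hq : q ∈ T.start) : T.Follows π 0 ⟨q, π, ∅⟩ :=
  ⟨rfl, hq, fun _ h => h.elim⟩

theorem IsFinTrial.follows {l : List (Step Q A)} (hl : T.IsFinTrial l)
    (hfb : T.forward π ⊆ T.backward π) (h0 : ∀ h : 0 < l.length, T.Follows π 0 l[0].src) :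
    ∀ n (h : n < l.length), T.Follows π n l[n].src
  | 0, h => h0 h
  | n + 1, h => by
    have ⟨_, hchain, hvalid, _, hnr⟩ := hl
    rw [← hchain n h]
    exact (IsFinTrial.follows hl hfb h0 n _).tgt hfb (hvalid _ (List.getElem_mem _)) (hnr n h)

theorem IsInfTrial.follows {g : ℕ → Step Q A} (hg : T.IsInfTrial g)
    (hfb : T.forward π ⊆ T.backward π) (h0 : T.Follows π 0 (g 0).src) (n : ℕ) :
    T.Follows π n (g n).src := by
  induction n with
  | zero => exact h0
  | succ n ih => exact hg.2.1 n ▸ ih.tgt hfb (hg.1 n) (hg.2.2 n)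

theorem IsTrial.follows {tr : Trial Q A} (htr : T.IsTrial tr)
    (hfb : T.forward π ⊆ T.backward π) {q : Q} (hq : q ∈ T.start)
    (hfirst : tr.config? 0 = some ⟨q, π, ∅⟩) {n : ℕ} (hn : tr.NonTerminal n)
    {c : Config Q A} (hc : tr.config? n = some c) : T.Follows π n c := by
  cases tr with
  | fin l =>
    have hn' : n < l.length := hn
    simp only [Trial.config?, dif_pos hn', Option.some.injEq] at hc
    subst hc
    refine IsFinTrial.follows htr hfb (fun h => ?_) n hn'
    simp only [Trial.config?, dif_pos h, Option.some.injEq] at hfirst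
    exact hfirst ▸ follows_start hq
  | inf g =>
    obtain rfl : (g n).src = c := Option.some.inj hc
    have h0 : (g 0).src = ⟨q, π, ∅⟩ := Option.some.inj hfirst
    exact IsInfTrial.follows htr hfb (h0 ▸ follows_start hq) n

theorem IsTrial.pol_eq {tr : Trial Q A} (htr : T.IsTrial tr)
    (hfb : T.forward π ⊆ T.backward π) {q : Q} (hq : q ∈ T.start)
    (hfirst : tr.config? 0 = some ⟨q, π, ∅⟩) {n : ℕ}
    {c : Config Q A} (hc : tr.config? n = some c) : c.pol = π := by
  by_cases hn : tr.NonTerminal n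
  · exact (htr.follows hfb hq hfirst hn hc).pol_eq
  cases tr with
  | inf g => exact absurd trivial hn
  | fin l =>
    have hn' : ¬ n < l.length := hn
    have hpos : l.length - 1 < l.length := by
      have := List.length_pos_of_ne_nil htr.1
      omega
    have hlast : T.Follows π (l.length - 1) l[l.length - 1].src :=
      htr.follows hfb hq hfirst (n := l.length - 1) hpos
        (by simp only [Trial.config?, dif_pos hpos])
    simp only [Trial.config?, dif_neg hn', Option.ite_none_right_eq_some] at hc
    rw [lastTgt?, List.getLast?_eq_getElem?, List.getElem?_eq_getElem hpos, Option.map_some,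
      Option.some.injEq] at hc
    exact hc.2 ▸ hlast.tgt_pol_eq (htr.2.2.1 _ (List.getElem_mem _))

end NavTask

/-- If `forward(π) ⊆ backward(π)`, then every trial starting in a
start configuration `(q₀, π, ∅)` with `q₀ ∈ Q₀` keeps the policy `π` at every
configuration (including the terminal one, if any), has no branching
configuration at a non-terminal position, and the state of its `i`-th
(non-terminal) configuration lies in the `i`-th forward layer of `π`. -/
theorem trial_follows_forward {Q A : Type} [Fintype Q] [Fintype A]
    (T : NavTask Q A) (π : Q → A) (hfb : T.forward π ⊆ T.backward π)
    (tr : Trial Q A) (htr : T.IsTrial tr)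
    (q₀ : Q) (hq₀ : q₀ ∈ T.start)
    (hfirst : tr.config? 0 = some ⟨q₀, π, ∅⟩) :
    (∀ n c, tr.config? n = some c → c.pol = π) ∧
    (∀ n, tr.NonTerminal n → ∀ c, tr.config? n = some c → ¬ c.Branching) ∧
    (∀ n, tr.NonTerminal n → ∀ c, tr.config? n = some c → c.state ∈ T.fwd π n) := by
  have follows {n c} := NavTask.IsTrial.follows htr hfb hq₀ hfirst (n := n) (c := c)
  exact ⟨fun _ _ => htr.pol_eq hfb hq₀ hfirst,
    fun _ hn _ hc => (follows hn hc).not_branching,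
    fun _ hn _ hc => (follows hn hc).state_mem⟩
end

section
/- Let T be a task, let R be a converging fair run on T with convergence-trial index i and final policy π. Then every state q ∈ forward(π) occurs infinitely often at non-terminal positions in R after trial i. -/
theorem NavTask.ValidStep.tgt_pol_eq {Q A : Type} {T : NavTask Q A} {t : Step Q A}
    (ht : T.ValidStep t) (hb : ¬ t.src.Branching) : t.tgt.pol = t.src.pol := by
  obtain ⟨⟨h | h, -⟩, htgt⟩ := ht
  · exact absurd h hb
  · dsimp only at h
    simp [htgt, Config.apply, h]

theorem NavTask.IsFinTrial.pol_eq_of_not_branching {Q A : Type} {T : NavTask Q A}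
    {l : List (Step Q A)} (hl : T.IsFinTrial l) (hb : ∀ t ∈ l, ¬ t.src.Branching) {π : Q → A}
    (h₀ : ∀ c ∈ firstSrc? l, c.pol = π) : ∀ t ∈ l, t.src.pol = π ∧ t.tgt.pol = π := by
  obtain ⟨-, hchain, hvalid, -, -⟩ := hl
  have htgt : ∀ t ∈ l, t.src.pol = π → t.tgt.pol = π := fun t ht hs ↦
    ((hvalid t ht).tgt_pol_eq (hb t ht)).trans hs
  have hsrc : ∀ j (h : j < l.length), (l[j]'h).src.pol = π := by
    intro j
    induction j with
    | zero =>
      intro h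
      apply h₀
      simp [firstSrc?, List.head?_eq_getElem?, List.getElem?_eq_getElem h]
    | succ j ih =>
      intro h
      rw [← hchain j h]
      exact htgt _ (List.getElem_mem _) (ih _)
  intro t ht
  obtain ⟨j, h, rfl⟩ := List.getElem_of_mem ht
  exact ⟨hsrc j h, htgt _ ht (hsrc j h)⟩

/-- After a trial beyond which no configuration branches, the policy no longer changes. -/
theorem NavTask.IsRun.pol_eq_of_noBranchingAfter {Q A : Type} {T : NavTask Q A}
    {f : ℕ → List (Step Q A)} (hrun : T.IsRun (.allFin f)) {i : ℕ}
    (hb : (Run.allFin f).NoBranchingAfter i) {π : Q → A}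
    (hπ : (Run.allFin f).EndPolicyAt i π) {m : ℕ} (hm : i < m) :
    ∀ t ∈ f m, t.src.pol = π := by
  obtain ⟨hfin, -, hsucc, -⟩ := hrun
  have key : ∀ k, i ≤ k → (Run.allFin f).EndPolicyAt k π →
      ∀ t ∈ f (k + 1), t.src.pol = π ∧ t.tgt.pol = π := by
    rintro k hk ⟨t, ht, htπ⟩
    refine (hfin (k + 1)).pol_eq_of_not_branching (hb _ (by omega)) fun c hc ↦ ?_
    have hlast : t.tgt ∈ lastTgt? (f k) := by
      simp only [lastTgt?, Option.mem_def] at ht ⊢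
      simp [ht]
    exact (hsucc k _ hlast c hc).2.1.trans htπ
  have hend : ∀ k, i ≤ k → (Run.allFin f).EndPolicyAt k π := by
    intro k hk
    induction k, hk using Nat.le_induction with
    | base => exact hπ
    | succ k hk ih =>
      have hne := (hfin (k + 1)).1
      exact ⟨(f (k + 1)).getLast hne, List.getLast?_eq_some_getLast hne,
        (key k hk ih _ (List.getLast_mem hne)).2⟩
  obtain ⟨k, rfl⟩ : ∃ k, m = k + 1 := ⟨m - 1, by omega⟩
  exact fun t ht ↦ (key k (by omega) (hend k (by omega)) t ht).1

theorem Run.infOftenFrom_allFin_iff {Q A : Type} {f : ℕ → List (Step Q A)}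
    {P : Step Q A → Prop} (i : ℕ) :
    (Run.allFin f).InfOftenFrom i P ↔ (Run.allFin f).InfOften P := by
  refine ⟨fun h ↦ Set.Infinite.mono (fun p hp ↦ ⟨Nat.zero_le _, hp.2⟩) h, fun h hfin ↦ h ?_⟩
  have hinit : (⋃ n ∈ Set.Iio i, Prod.mk n '' Set.Iio (f n).length).Finite :=
    (Set.finite_Iio i).biUnion fun n _ ↦ (Set.finite_Iio _).image _
  refine (hfin.union hinit).subset ?_
  rintro ⟨m, j⟩ ⟨-, hj, hP⟩
  by_cases hm : i ≤ m
  · exact Or.inl ⟨hm, hj, hP⟩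
  · right
    simpa using And.intro hj (lt_of_not_ge hm)

/-- If a predicate holds infinitely often, some single configuration is the source of
infinitely many of its occurrences. -/
theorem Run.InfOftenFrom.exists_config {Q A : Type} [Finite Q] [Finite A]
    {f : ℕ → List (Step Q A)} {P : Step Q A → Prop} {i : ℕ}
    (h : (Run.allFin f).InfOftenFrom i P) :
    ∃ c : Config Q A, (Run.allFin f).InfOftenFrom i (fun t ↦ t.src = c ∧ P t) := by
  have hinj : Function.Injective
      (fun c : Config Q A ↦ (c.state, c.pol, c.mem)) := by
    rintro ⟨⟩ ⟨⟩ h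
    simpa using h
  have : Finite (Config Q A) := Finite.of_injective _ hinj
  by_contra! hc
  refine h ((Set.finite_iUnion fun c ↦ Set.not_infinite.mp (hc c)).subset ?_)
  rintro p ⟨hi, hp, hP⟩
  exact Set.mem_iUnion.mpr ⟨_, hi, hp, rfl, hP⟩

/-- In a converging fair run with convergence-trial index `i` and
final policy `π`, every state of `forward(π)` occurs infinitely often at
non-terminal positions after trial `i`. -/
theorem forward_states_inf_often_after_convergence {Q A : Type} [Fintype Q] [Fintype A]
    (T : NavTask Q A)
    (R : Run Q A) (hrun : T.IsRun R) (hfair : T.Fair R) (hconv : R.Converges)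
    (i : ℕ) (hi : R.IsConvIndex i) (π : Q → A) (hπ : R.EndPolicyAt i π) :
    ∀ q ∈ T.forward π, R.InfOftenFrom (i + 1) (fun t => t.src.state = q) := by
  cases R with
  | withInf L g => exact hconv.1.elim
  | allFin f =>
    have hpol := fun m (hm : i < m) ↦ hrun.pol_eq_of_noBranchingAfter hi.2.1 hπ hm
    obtain ⟨hfin, -, -, hstart⟩ := hrun
    intro q hq
    obtain ⟨n, hn⟩ := Set.mem_iUnion.mp hq
    clear hq
    induction n generalizing q with
    | zero =>
      rw [Run.infOftenFrom_allFin_iff]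
      refine ((hstart q hn).image (f := fun m ↦ (m, 0))
        fun _ _ _ _ h ↦ congrArg Prod.fst h).mono ?_
      rintro _ ⟨m, ⟨c, hc, rfl⟩, rfl⟩
      have hlen : 0 < (f m).length := List.length_pos_of_ne_nil (hfin m).1
      refine ⟨Nat.zero_le _, hlen, ?_⟩
      rw [firstSrc?, List.head?_eq_getElem?, List.getElem?_eq_getElem hlen] at hc
      simp only [Option.map_some, Option.mem_def, Option.some.injEq] at hc
      simp [hc]
    | succ n ih =>
      rcases hn with hn | hn
      · exact ih q hn
      simp only [Set.mem_iUnion] at hn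
      obtain ⟨p, ⟨hp, hground⟩, hq⟩ := hn
      obtain ⟨c, hc⟩ := (ih p hp).exists_config
      obtain ⟨⟨m, j⟩, hm, hj, rfl, rfl⟩ := Set.Infinite.nonempty hc
      have hcπ := hpol m hm _ (List.getElem_mem hj)
      set c := ((f m)[j]'hj).src
      have hopt : (π c.state, q) ∈ T.opts c := ⟨Or.inr (by rw [hcπ]), hq⟩
      have hocc : (Run.allFin f).InfOften (fun t ↦ t.src = c) :=
        (Run.infOftenFrom_allFin_iff (i + 1)).mp <| by
          refine Set.Infinite.mono ?_ hc
          rintro _ ⟨h, h', h'', -⟩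
          exact ⟨h, h', h''⟩
      have htaken := (Run.infOftenFrom_allFin_iff (i + 1)).mpr (hfair c hocc _ hopt)
      refine (Set.Infinite.image (f := Prod.map id Nat.succ)
        (Function.injective_id.prodMap Nat.succ_injective).injOn htaken).mono ?_
      rintro _ ⟨⟨m', k⟩, ⟨hm', hk, hstep⟩, rfl⟩
      obtain ⟨-, hchain, -, hlast, -⟩ := hfin m'
      dsimp only at hm' hk hstep
      have hk' : k + 1 < (f m').length := by
        by_contra hk'
        refine hground ?_
        have hr := hlast ((f m')[k]'hk) (by
          rw [List.getLast?_eq_getElem?, show (f m').length - 1 = k by omega,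
            List.getElem?_eq_getElem hk]
          rfl)
        rwa [hstep] at hr
      refine ⟨hm', hk', ?_⟩
      have h := hchain k hk'
      rw [hstep] at h
      exact congrArg Config.state h.symm
end

section
/- If a task T = (Q, Q₀, A, rewards, δ) is learnable under fairness, then the start states are reducible to goals(T), i.e., Q₀ ⊆ reduce(T). -/
open Filter

section FairPath

/-- Any nonempty set of a countable type is enumerated with infinite repetition. -/
theorem exists_enum_infinite_fibers {X : Type*} [Countable X] (s : Set X) (hs : s.Nonempty) :
    ∃ σ : ℕ → X, (∀ k, σ k ∈ s) ∧ ∀ e ∈ s, {k | σ k = e}.Infinite := by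
  have := hs.to_subtype
  obtain ⟨g, hg⟩ := exists_surjective_nat s
  refine ⟨fun k => g k.unpair.1, fun k => (g _).2, fun e he => ?_⟩
  obtain ⟨j, hj⟩ := hg ⟨e, he⟩
  refine (Set.infinite_range_of_injective (f := fun m => Nat.pair j m) ?_).mono ?_
  · intro a b h
    exact (Nat.pair_eq_pair.1 h).2
  · rintro _ ⟨m, rfl⟩
    simp [hj]

/-- In a countably labelled transition system without dead ends there is an infinite path that
takes every label enabled at an infinitely often visited node infinitely often. -/
theorem exists_fair_path {C X : Type*} [Countable X] (E : C → Set X) (hE : ∀ c, (E c).Nonempty)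
    (next : C → X → C) (c₀ : C) :
    ∃ (node : ℕ → C) (label : ℕ → X), node 0 = c₀ ∧ (∀ n, label n ∈ E (node n)) ∧
      (∀ n, node (n + 1) = next (node n) (label n)) ∧
      ∀ c, (∃ᶠ n in atTop, node n = c) → ∀ e ∈ E c,
        ∃ᶠ n in atTop, node n = c ∧ label n = e := by
  classical
  choose σ hσ hσ' using fun c => exists_enum_infinite_fibers (E c) (hE c)
  let st : ℕ → C × (C → ℕ) := fun n => Nat.rec (c₀, fun _ => 0)
    (fun _ x => (next x.1 (σ x.1 (x.2 x.1)), Function.update x.2 x.1 (x.2 x.1 + 1))) n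
  have hst : ∀ n, st (n + 1) = (next (st n).1 (σ (st n).1 ((st n).2 (st n).1)),
      Function.update (st n).2 (st n).1 ((st n).2 (st n).1 + 1)) := fun n => rfl
  have hcount : ∀ c n, (st n).2 c = Nat.count (fun m => (st m).1 = c) n := by
    intro c n
    induction n with
    | zero => simp [st]
    | succ n ih =>
      rw [Nat.count_succ, ← ih, hst]
      by_cases h : (st n).1 = c
      · subst h; simp
      · simp [h, Function.update_of_ne (Ne.symm h)]
  refine ⟨fun n => (st n).1, fun n => σ (st n).1 ((st n).2 (st n).1), rfl, fun n => hσ _ _,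
    fun n => congrArg Prod.fst (hst n), fun c hc e he => ?_⟩
  rw [Nat.frequently_atTop_iff_infinite] at hc ⊢
  refine ((hσ' c e he).image (Nat.nth_injective hc).injOn).mono ?_
  rintro _ ⟨k, hk, rfl⟩
  have hmem : (st (Nat.nth (fun m => (st m).1 = c) k)).1 = c := Nat.nth_mem_of_infinite hc k
  refine ⟨hmem, ?_⟩
  dsimp only
  rw [hmem, hcount, Nat.count_nth_of_infinite hc]
  exact hk

theorem exists_frequently_of_finite {ι α : Type*} [Finite ι] {l : Filter α} {p : ι → α → Prop}
    (h : ∃ᶠ x in l, ∃ i, p i x) : ∃ i, ∃ᶠ x in l, p i x := by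
  by_contra! hn
  refine h ((eventually_all.2 hn).mono fun x hx => ?_)
  rintro ⟨i, hi⟩
  exact hx i hi

theorem frequently_add_left_iff {P : ℕ → Prop} (N : ℕ) :
    (∃ᶠ n in atTop, P (N + n)) ↔ ∃ᶠ n in atTop, P n := by
  conv_rhs => rw [← map_add_atTop_eq_nat N, frequently_map]
  simp only [Nat.add_comm N]

end FairPath

section Blocks

variable {α : Type*}

/-- The consecutive blocks of a sequence `t` delimited by `b`. -/
def blocks (t : ℕ → α) (b : ℕ → ℕ) (i : ℕ) : List α :=
  List.ofFn fun j : Fin (b (i + 1) - b i) => t (b i + j)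

@[simp] theorem length_blocks (t : ℕ → α) (b : ℕ → ℕ) (i : ℕ) :
    (blocks t b i).length = b (i + 1) - b i := by simp [blocks]

@[simp] theorem getElem_blocks (t : ℕ → α) (b : ℕ → ℕ) (i j : ℕ)
    (h : j < (blocks t b i).length) : (blocks t b i)[j] = t (b i + j) := by simp [blocks]

theorem mem_blocks {t : ℕ → α} {b : ℕ → ℕ} {i : ℕ} {x : α} (h : x ∈ blocks t b i) :
    ∃ n, x = t n := by
  obtain ⟨j, hj, rfl⟩ := List.mem_iff_getElem.1 h
  exact ⟨_, getElem_blocks ..⟩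

theorem head?_blocks (t : ℕ → α) {b : ℕ → ℕ} (hb : StrictMono b) (i : ℕ) :
    (blocks t b i).head? = some (t (b i)) := by
  have := hb (Nat.lt_add_one i)
  rw [List.head?_eq_getElem?, List.getElem?_eq_getElem (by simp; omega)]
  simp

theorem getLast?_blocks (t : ℕ → α) {b : ℕ → ℕ} (hb : StrictMono b) (i : ℕ) :
    (blocks t b i).getLast? = some (t (b (i + 1) - 1)) := by
  have := hb (Nat.lt_add_one i)
  rw [List.getLast?_eq_getElem?, List.getElem?_eq_getElem (by simp; omega)]
  simp only [length_blocks, getElem_blocks]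
  congr 2
  omega

theorem exists_block_index {b : ℕ → ℕ} (hb : StrictMono b) (h0 : b 0 = 0) (n : ℕ) :
    ∃ i j, j < b (i + 1) - b i ∧ b i + j = n := by
  induction n with
  | zero =>
    have := hb (Nat.lt_add_one 0)
    exact ⟨0, 0, by omega, by omega⟩
  | succ n ih =>
    obtain ⟨i, j, hj, rfl⟩ := ih
    by_cases h : j + 1 < b (i + 1) - b i
    · exact ⟨i, j + 1, h, rfl⟩
    · have := hb (Nat.lt_add_one (i + 1))
      exact ⟨i + 1, 0, by omega, by omega⟩

theorem block_index_injOn {b : ℕ → ℕ} (hb : StrictMono b) :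
    Set.InjOn (fun p : ℕ × ℕ => b p.1 + p.2) {p | p.2 < b (p.1 + 1) - b p.1} := by
  have key : ∀ {i j i' j' : ℕ}, j < b (i + 1) - b i → b i + j = b i' + j' → i' ≤ i := by
    intro i j i' j' hj h
    by_contra! hlt
    have := hb.monotone (Nat.succ_le_of_lt hlt)
    simp only [Nat.succ_eq_add_one] at this
    omega
  rintro ⟨i, j⟩ hp ⟨i', j'⟩ hp' h
  obtain rfl : i = i' := le_antisymm (key hp' h.symm) (key hp h)
  simpa using h

theorem infinite_blocks_iff (t : ℕ → α) {b : ℕ → ℕ} (hb : StrictMono b) (h0 : b 0 = 0)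
    (P : α → Prop) :
    {p : ℕ × ℕ | 0 ≤ p.1 ∧ ∃ h : p.2 < (blocks t b p.1).length,
      P ((blocks t b p.1)[p.2]'h)}.Infinite ↔ ∃ᶠ n in atTop, P (t n) := by
  rw [Nat.frequently_atTop_iff_infinite, ← Set.infinite_image_iff ((block_index_injOn hb).mono _)]
  · refine iff_of_eq (congrArg _ (Set.ext fun n => ⟨?_, fun hn => ?_⟩))
    · rintro ⟨p, ⟨-, hp, hP⟩, rfl⟩
      simpa using hP
    · obtain ⟨i, j, hj, rfl⟩ := exists_block_index hb h0 n
      exact ⟨(i, j), ⟨Nat.zero_le _, by simpa using hj, by simpa using hn⟩, rfl⟩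
  · rintro p ⟨-, hp, -⟩
    simpa using hp

end Blocks

instance Config.instFinite {Q A : Type} [Finite Q] [Finite A] : Finite (Config Q A) :=
  Finite.of_injective (fun c : Config Q A => (c.state, c.pol, c.mem)) <| by
    rintro ⟨q, π, V⟩ ⟨q', π', V'⟩ h
    simpa using h

namespace NavTask

variable {Q A : Type}

theorem layers_mono (T : NavTask Q A) (S : Set Q) : Monotone (T.layers S) :=
  monotone_nat_of_le_succ fun _ => Set.subset_union_left

theorem exists_delta_notMem_reduce [Finite Q] (T : NavTask Q A) {q : Q} (hq : q ∉ T.reduce)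
    (a : A) : ∃ q' ∈ T.delta q a, q' ∉ T.reduce := by
  by_contra! h
  have h' : ∀ p : T.delta q a, ∃ n, (p : Q) ∈ T.layers T.goals n := fun p =>
    Set.mem_iUnion.1 (h p p.2)
  choose n hn using h'
  obtain ⟨N, hN⟩ := (Set.finite_range n).bddAbove
  refine hq (Set.mem_iUnion.2 ⟨N + 1, Or.inr ⟨a, fun p hp => ?_⟩⟩)
  exact T.layers_mono _ (hN ⟨⟨p, hp⟩, rfl⟩) (hn ⟨p, hp⟩)

theorem notMem_rewards_of_notMem_reduce (T : NavTask Q A) {q : Q} (hq : q ∉ T.reduce) (a : A) :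
    (q, a) ∉ T.rewards :=
  fun h => hq (Set.mem_iUnion.2 ⟨0, a, h⟩)

theorem opts_nonempty (T : NavTask Q A) (c : Config Q A) : (T.opts c).Nonempty := by
  obtain ⟨q', hq'⟩ := T.delta_nonempty c.state (c.pol c.state)
  exact ⟨(_, q'), Or.inr rfl, hq'⟩

/-- A sequence of transitions forming a concatenation of trials: nonrewarding transitions are
chained, and a new trial starts after each reward transition. -/
structure IsTransitionSeq (T : NavTask Q A) (t : ℕ → Step Q A) : Prop where
  valid : ∀ n, T.ValidStep (t n)
  start : T.IsStartConfig (t 0).src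
  chain : ∀ n, ¬ T.IsRewardStep (t n) → (t n).tgt = (t (n + 1)).src
  succession : ∀ n, T.IsRewardStep (t n) → T.Succession (t n).tgt (t (n + 1)).src

/-- Fairness for a sequence of transitions. -/
def FairSeq (T : NavTask Q A) (t : ℕ → Step Q A) : Prop :=
  ∀ c, (∃ᶠ n in atTop, (t n).src = c) → ∀ p ∈ T.opts c,
    ∃ᶠ n in atTop, t n = ⟨c, p.1, p.2, c.apply p.1 p.2⟩

theorem exists_fair_transitionSeq [Finite Q] [Finite A] (T : NavTask Q A) :
    ∃ t : ℕ → Step Q A, T.IsTransitionSeq t ∧ T.FairSeq t ∧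
      ((∃ᶠ n in atTop, T.IsRewardStep (t n)) → ∀ q ∈ T.start,
        ∃ᶠ n in atTop, T.IsRewardStep (t n) ∧ (t (n + 1)).src.state = q) := by
  classical
  obtain ⟨s₀, hs₀⟩ := T.start_nonempty
  obtain ⟨⟨-, a₀⟩, -⟩ := T.rewards_nonempty
  let next : Config Q A → (A × Q) × Q → Config Q A := fun c e =>
    if (c.state, e.1.1) ∈ T.rewards then ⟨e.2, (c.apply e.1.1 e.1.2).pol, ∅⟩
    else c.apply e.1.1 e.1.2
  obtain ⟨node, label, h0, hlabel, hnext, hfair⟩ :=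
    exists_fair_path (fun c => T.opts c ×ˢ T.start)
      (fun c => (T.opts_nonempty c).prod T.start_nonempty) next ⟨s₀, fun _ => a₀, ∅⟩
  let t : ℕ → Step Q A := fun n => ⟨node n, (label n).1.1, (label n).1.2,
    (node n).apply (label n).1.1 (label n).1.2⟩
  refine ⟨t, ⟨fun n => ⟨(hlabel n).1, rfl⟩, ?_, fun n hn => ?_, fun n hn => ?_⟩,
    fun c hc p hp => ?_, fun hr q hq => ?_⟩
  · exact ⟨by simpa [t, h0] using hs₀, by simp [t, h0]⟩
  · have : (node n |>.state, (label n).1.1) ∉ T.rewards := hn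
    simp [t, hnext, next, this]
  · have : (node n |>.state, (label n).1.1) ∈ T.rewards := hn
    refine ⟨?_, ?_, ?_⟩
    · simpa [t, hnext, next, this] using (hlabel n).2
    · simp [t, hnext, next, this]
    · simp [t, hnext, next, this]
  · refine (hfair c hc (p, s₀) ⟨hp, hs₀⟩).mono ?_
    rintro n ⟨rfl, h⟩
    simp [t, h]
  · obtain ⟨⟨c, p⟩, hcp⟩ := exists_frequently_of_finite
      (p := fun (x : Config Q A × (A × Q)) n =>
        T.IsRewardStep (t n) ∧ node n = x.1 ∧ (label n).1 = x.2)
      (hr.mono fun n hn => ⟨(node n, (label n).1), hn, rfl, rfl⟩)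
    obtain ⟨n₀, hn₀, rfl, rfl⟩ := hcp.exists
    refine (hfair (node n₀) (hcp.mono fun n h => h.2.1) ((label n₀).1, q)
      ⟨(hlabel n₀).1, hq⟩).mono ?_
    rintro n ⟨h1, h2⟩
    have hrew : (node n |>.state, (label n).1.1) ∈ T.rewards := by
      rw [h1, h2]; exact hn₀
    refine ⟨hrew, ?_⟩
    simp only [t, hnext, next, if_pos hrew]
    rw [h2]

/-- If finitely many transitions are rewarding, the part after the last one is a run. -/
theorem exists_fair_run_of_eventually_not_reward {T : NavTask Q A} {t : ℕ → Step Q A}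
    (ht : T.IsTransitionSeq t) (hf : T.FairSeq t)
    (hr : ¬ ∃ᶠ n in atTop, T.IsRewardStep (t n)) :
    ∃ R : Run Q A, T.IsRun R ∧ T.Fair R ∧ ¬ R.AllFinite := by
  classical
  obtain ⟨N, hN, hstart⟩ : ∃ N, (∀ n, ¬ T.IsRewardStep (t (N + n))) ∧
      T.IsStartConfig (t N).src := by
    have hex : ∃ N, ∀ n ≥ N, ¬ T.IsRewardStep (t n) :=
      eventually_atTop.1 (not_frequently.1 hr)
    refine ⟨Nat.find hex, fun n => Nat.find_spec hex _ (Nat.le_add_right _ _), ?_⟩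
    rcases h : Nat.find hex with _ | m
    · exact ht.start
    · have hm : ¬ ∀ n ≥ m, ¬ T.IsRewardStep (t n) := Nat.find_min hex (by omega)
      push Not at hm
      obtain ⟨n, hmn, hn⟩ := hm
      have hlt : n < m + 1 := by
        by_contra! hle
        exact Nat.find_spec hex n (h ▸ hle) hn
      obtain rfl : n = m := by omega
      exact ⟨(ht.succession n hn).1, (ht.succession n hn).2.2⟩
  have hinf : ∀ P : Step Q A → Prop,
      (Run.withInf [] fun n => t (N + n)).InfOften P ↔ ∃ᶠ n in atTop, P (t n) := by
    intro P
    rw [← frequently_add_left_iff N, Nat.frequently_atTop_iff_infinite]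
    simp [Run.InfOften, Run.InfOftenFrom]
  refine ⟨.withInf [] fun n => t (N + n), ?_, fun c hc p hp => ?_, id⟩
  · refine ⟨by simp, ⟨fun n => ht.valid _, fun n => ht.chain _ (hN n), hN⟩, fun _ => hstart,
      by simp, by simp, by simp [lastTgt?]⟩
  · rw [hinf] at hc ⊢
    exact hf c hc p hp

/-- A transition sequence with infinitely many rewards decomposes into a run of finite trials. -/
theorem exists_run_of_frequently_reward {T : NavTask Q A} {t : ℕ → Step Q A}
    (ht : T.IsTransitionSeq t) (hr : ∃ᶠ n in atTop, T.IsRewardStep (t n))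
    (hs : ∀ q ∈ T.start, ∃ᶠ n in atTop, T.IsRewardStep (t n) ∧ (t (n + 1)).src.state = q) :
    ∃ R : Run Q A, T.IsRun R ∧ ∀ P, R.InfOften P ↔ ∃ᶠ n in atTop, P (t n) := by
  classical
  let rew : ℕ → Prop := fun n => T.IsRewardStep (t n)
  have hinf : {n | rew n}.Infinite := Nat.frequently_atTop_iff_infinite.1 hr
  let b : ℕ → ℕ
    | 0 => 0
    | i + 1 => Nat.nth rew i + 1
  have hb : StrictMono b := strictMono_nat_of_lt_succ fun i => by
    cases i with
    | zero => exact Nat.succ_pos _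
    | succ i => exact Nat.succ_lt_succ (Nat.nth_strictMono hinf i.lt_succ_self)
  have hlast : ∀ i, rew (b (i + 1) - 1) := fun i => Nat.nth_mem_of_infinite hinf i
  have hnot : ∀ i n, b i ≤ n → n + 1 < b (i + 1) → ¬ rew n := by
    intro i n h1 h2 hn
    rw [← Nat.nth_count hn] at h1 h2
    have h3 : Nat.count rew n < i :=
      (Nat.nth_strictMono hinf).lt_iff_lt.1 (Nat.lt_of_succ_lt_succ h2)
    cases i with
    | zero => omega
    | succ i =>
      have := (Nat.nth_strictMono hinf).lt_iff_lt.1 (Nat.lt_of_succ_le h1)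
      omega
  refine ⟨.allFin (blocks t b), ⟨fun i => ⟨?_, ?_, ?_, ?_, ?_⟩, ?_, ?_, ?_⟩, fun P =>
    infinite_blocks_iff t hb rfl P⟩
  · intro h
    have := head?_blocks t hb i
    simp [h] at this
  · intro j hj
    rw [length_blocks] at hj
    rw [getElem_blocks, getElem_blocks]
    exact ht.chain _ (hnot i _ (Nat.le_add_right _ _) (by omega))
  · intro x hx
    obtain ⟨n, rfl⟩ := mem_blocks hx
    exact ht.valid n
  · simp only [getLast?_blocks t hb, Option.mem_some_iff, forall_eq']
    exact hlast i
  · intro j hj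
    rw [length_blocks] at hj
    rw [getElem_blocks]
    exact hnot i _ (Nat.le_add_right _ _) (by omega)
  · simp only [firstSrc?, head?_blocks t hb, Option.map_some, Option.mem_some_iff, forall_eq']
    exact ht.start
  · intro i
    simp only [firstSrc?, lastTgt?, head?_blocks t hb, getLast?_blocks t hb, Option.map_some,
      Option.mem_some_iff, forall_eq']
    exact ht.succession _ (hlast i)
  · intro q hq
    have hq' := Nat.frequently_atTop_iff_infinite.1 (hs q hq)
    refine (hq'.image (f := fun n => Nat.count rew n + 1) ?_).mono ?_
    · intro m hm n hn h
      exact Nat.count_injective hm.1 hn.1 (Nat.succ_injective h)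
    · rintro _ ⟨n, ⟨hn, hnq⟩, rfl⟩
      simp only [firstSrc?, head?_blocks t hb, Option.map_some, Option.mem_some_iff,
        Set.mem_ofPred_eq, exists_eq_left']
      change (t (Nat.nth rew (Nat.count rew n) + 1)).src.state = q
      rwa [Nat.nth_count hn]

/-- In a fair transition sequence that visits an irreducible state infinitely often, some
branching configuration occurs infinitely often. -/
theorem FairSeq.exists_branching [Finite Q] [Finite A] {T : NavTask Q A} {t : ℕ → Step Q A}
    (ht : T.IsTransitionSeq t) (hf : T.FairSeq t) {q : Q} (hq : q ∉ T.reduce)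
    (hfreq : ∃ᶠ n in atTop, (t n).src.state = q) :
    ∃ c : Config Q A, c.Branching ∧ ∃ᶠ n in atTop, (t n).src = c := by
  by_contra! hno
  have grow : ∀ k, ∃ c : Config Q A, c.state ∉ T.reduce ∧ k ≤ c.mem.ncard ∧
      ∃ᶠ n in atTop, (t n).src = c := by
    intro k
    induction k with
    | zero =>
      obtain ⟨c, hc⟩ := exists_frequently_of_finite
        (p := fun (c : Config Q A) n => (t n).src = c ∧ c.state = q)
        (hfreq.mono fun n hn => ⟨_, rfl, hn⟩)
      obtain ⟨-, -, rfl⟩ := hc.exists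
      exact ⟨c, hq, Nat.zero_le _, hc.mono fun n h => h.1⟩
    | succ k ih =>
      obtain ⟨c, hc, hk, hcf⟩ := ih
      obtain ⟨q', hq', hq'r⟩ := T.exists_delta_notMem_reduce hc (c.pol c.state)
      have hnb : c.state ∉ c.mem := fun h => hcf ((hno c h).mono fun _ hn => hn)
      refine ⟨c.apply (c.pol c.state) q', hq'r, ?_, ?_⟩
      · change k + 1 ≤ (c.mem ∪ {c.state}).ncard
        rw [Set.union_singleton, Set.ncard_insert_of_notMem hnb]
        omega
      · have := hf c hcf (c.pol c.state, q') ⟨Or.inr rfl, hq'⟩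
        rw [← frequently_add_left_iff 1]
        refine this.mono fun n hn => ?_
        have hnr : ¬ T.IsRewardStep (t n) := by
          rw [hn]
          exact T.notMem_rewards_of_notMem_reduce hc _
        rw [Nat.add_comm, ← ht.chain n hnr, hn]
  obtain ⟨c, -, hc, -⟩ := grow (Nat.card Q + 1)
  have := Set.ncard_le_card c.mem
  omega

end NavTask

/-- If a task is learnable under fairness, then the start states
are reducible to the goal states. -/
theorem learnable_start_reducible {Q A : Type} [Fintype Q] [Fintype A]
    (T : NavTask Q A) (hlearn : T.Learnable) :
    T.start ⊆ T.reduce := by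
  intro q hq
  by_contra hred
  obtain ⟨t, ht, hf, hs⟩ := T.exists_fair_transitionSeq
  by_cases hr : ∃ᶠ n in atTop, T.IsRewardStep (t n)
  · obtain ⟨R, hR, hinf⟩ := NavTask.exists_run_of_frequently_reward ht hr (hs hr)
    have hfair : T.Fair R := fun c hc p hp => (hinf _).2 (hf c ((hinf _).1 hc) p hp)
    have hfreq : ∃ᶠ n in atTop, (t n).src.state = q :=
      (frequently_add_left_iff 1).1 ((hs hr q hq).mono fun n hn => by
        rw [Nat.add_comm]
        exact hn.2)
    obtain ⟨c, hb, hc⟩ := hf.exists_branching ht hred hfreq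
    refine (hlearn R hR hfair).2 c.state ((hinf _).2 (hc.mono fun n hn => ?_))
    rw [hn]
    exact ⟨rfl, hb⟩
  · obtain ⟨R, hR, hfair, hnf⟩ := NavTask.exists_fair_run_of_eventually_not_reward ht hf hr
    exact hnf (hlearn R hR hfair).1
end
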